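/- arXiv:2411.16397 — 2 statements merged into one kernel-verified Lean document; each statement's English description precedes it below -/
import Mathlib

section
/- For all KA terms (i.e., complement-free terms built from variables, 0, 1, union, composition, and Kleene star) t and s, the equation t = s holds in every language model under every valuation (LANG ⊨ t = s) if and only if the regular languages ⟦t⟧ and ⟦s⟧ over the alphabet V, obtained under the standard valuation sending each variable x to the singleton language {x}, are equal. -/
/-- Kleene algebra terms (complement-free), over the countably infinite
variable set `ℕ`. -/
inductive KA : Type where
  | var : ℕ → KA
  | zero : KA
  | one : KA
  | add : KA → KA → KA
  | comp : KA → KA → KA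
  | star : KA → KA

/-- Composition (concatenation) of languages. -/
def cat {X : Type} (L M : Set (List X)) : Set (List X) :=
  {w | ∃ u ∈ L, ∃ v ∈ M, w = u ++ v}

/-- Kleene star of a language. -/
def kstar {X : Type} (L : Set (List X)) : Set (List X) :=
  {w | ∃ ws : List (List X), (∀ u ∈ ws, u ∈ L) ∧ w = ws.flatten}

/-- The interpretation `v̂(t)` of a KA term under a valuation `v : V → P(X*)`. -/
def eval {X : Type} (v : ℕ → Set (List X)) : KA → Set (List X)
  | .var x => v x
  | .zero => ∅
  | .one => {[]}
  | .add t s => eval v t ∪ eval v s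
  | .comp t s => cat (eval v t) (eval v s)
  | .star t => kstar (eval v t)

/-- The standard language valuation over the alphabet `V = ℕ`, sending each
variable `x` to the singleton language `{x}`. -/
def stdVal : ℕ → Set (List ℕ) := fun x => {[x]}

/-- The image of a word of variables under a valuation: the concatenation of the
languages assigned to its letters. -/
def wordEval {X : Type} (v : ℕ → Set (List X)) : List ℕ → Set (List X)
  | [] => {[]}
  | x :: a => cat (v x) (wordEval v a)

theorem mem_wordEval_append {X : Type} (v : ℕ → Set (List X)) (a b : List ℕ) (w : List X) :
    w ∈ wordEval v (a ++ b) ↔ ∃ p ∈ wordEval v a, ∃ q ∈ wordEval v b, w = p ++ q := by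
  induction a generalizing w with
  | nil => simp [wordEval]
  | cons x a ih =>
    constructor
    · rintro ⟨p, hp, r, hr, rfl⟩
      obtain ⟨q, hq, q', hq', rfl⟩ := (ih r).1 hr
      exact ⟨p ++ q, ⟨p, hp, q, hq, rfl⟩, q', hq', (List.append_assoc ..).symm⟩
    · rintro ⟨_, ⟨p, hp, q, hq, rfl⟩, q', hq', rfl⟩
      exact ⟨p, hp, q ++ q', (ih _).2 ⟨q, hq, q', hq', rfl⟩, List.append_assoc ..⟩

/-- The value of a term under any valuation is determined by its standard language. -/
theorem mem_eval_iff {X : Type} (v : ℕ → Set (List X)) (t : KA) (w : List X) :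
    w ∈ eval v t ↔ ∃ a ∈ eval stdVal t, w ∈ wordEval v a := by
  induction t generalizing w with
  | var x => simp [eval, stdVal, wordEval, cat]
  | zero => simp [eval]
  | one => simp [eval, wordEval]
  | add t s iht ihs => simp only [eval, Set.mem_union, iht, ihs, or_and_right, exists_or]
  | comp t s iht ihs =>
    constructor
    · rintro ⟨p, hp, q, hq, rfl⟩
      obtain ⟨a, ha, hpa⟩ := (iht p).1 hp
      obtain ⟨b, hb, hqb⟩ := (ihs q).1 hq
      exact ⟨a ++ b, ⟨a, ha, b, hb, rfl⟩, (mem_wordEval_append ..).2 ⟨p, hpa, q, hqb, rfl⟩⟩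
    · rintro ⟨_, ⟨a, ha, b, hb, rfl⟩, hw⟩
      obtain ⟨p, hp, q, hq, rfl⟩ := (mem_wordEval_append ..).1 hw
      exact ⟨p, (iht p).2 ⟨a, ha, hp⟩, q, (ihs q).2 ⟨b, hb, hq⟩, rfl⟩
  | star t ih =>
    constructor
    · rintro ⟨ws, hws, rfl⟩
      induction ws with
      | nil => exact ⟨[], ⟨[], by simp, rfl⟩, rfl⟩
      | cons p ws ihw =>
        rw [List.forall_mem_cons] at hws
        obtain ⟨a, ha, hpa⟩ := (ih p).1 hws.1
        obtain ⟨_, ⟨as, has, rfl⟩, hw⟩ := ihw hws.2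
        exact ⟨_, ⟨a :: as, List.forall_mem_cons.2 ⟨ha, has⟩, rfl⟩,
          (mem_wordEval_append ..).2 ⟨p, hpa, _, hw, rfl⟩⟩
    · rintro ⟨_, ⟨as, has, rfl⟩, hw⟩
      induction as generalizing w with
      | nil => exact ⟨[], by simp, hw⟩
      | cons a as iha =>
        rw [List.forall_mem_cons] at has
        obtain ⟨p, hp, q, hq, rfl⟩ := (mem_wordEval_append ..).1 hw
        obtain ⟨ws, hws, rfl⟩ := iha q has.2 hq
        exact ⟨p :: ws, List.forall_mem_cons.2 ⟨(ih p).2 ⟨a, has.1, hp⟩, hws⟩, rfl⟩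

/-- For KA terms `t`, `s`: `LANG ⊨ t = s` iff `⟦t⟧ = ⟦s⟧` under the standard
language valuation. -/
theorem stmt1 (t s : KA) :
    (∀ (X : Type) (v : ℕ → Set (List X)), eval v t = eval v s) ↔
    eval stdVal t = eval stdVal s := by
  refine ⟨fun h => h ℕ stdVal, fun h X v => ?_⟩
  ext w
  rw [mem_eval_iff, mem_eval_iff, h]
end

section
/- Let n ≥ 2 be a natural number. For all KA terms (complement-free terms) t and s: LANG_n ⊨ t ≤ s if and only if LANG_2 ⊨ t ≤ s, i.e., v̂(t) ⊆ v̂(s) holds for all valuations over sets of cardinality at most n if and only if it holds for all valuations over sets of cardinality at most 2. -/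
/-- The monoid homomorphism `X* → {0, 1}*` sending a letter `x` to `0 ^ e x` followed by `1`. -/
def unaryCode {X : Type} (e : X → ℕ) (w : List X) : List Bool :=
  w.flatMap fun x => List.replicate (e x) false ++ [true]

theorem replicate_false_append_true_cons_inj {k l : ℕ} {a b : List Bool}
    (h : List.replicate k false ++ true :: a = List.replicate l false ++ true :: b) :
    k = l ∧ a = b := by
  induction k generalizing l with
  | zero => cases l <;> simp_all [List.replicate_succ]
  | succ k ih =>
    cases l with
    | zero => simp [List.replicate_succ] at h
    | succ l =>
      simp only [List.replicate_succ, List.cons_append, List.cons.injEq, true_and] at h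
      simpa using ih h

theorem unaryCode_append {X : Type} (e : X → ℕ) (u w : List X) :
    unaryCode e (u ++ w) = unaryCode e u ++ unaryCode e w := by
  simp [unaryCode]

theorem unaryCode_flatten {X : Type} (e : X → ℕ) (ws : List (List X)) :
    unaryCode e ws.flatten = (ws.map (unaryCode e)).flatten := by
  induction ws with
  | nil => rfl
  | cons w ws ih => simp [unaryCode_append, ih]

theorem unaryCode_injective {X : Type} {e : X → ℕ} (he : Function.Injective e) :
    Function.Injective (unaryCode e) := by
  intro u
  induction u with
  | nil => intro w h; cases w <;> simp_all [unaryCode]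
  | cons x u ih =>
    intro w h
    cases w with
    | nil => simp [unaryCode] at h
    | cons y w =>
      simp only [unaryCode, List.flatMap_cons, List.append_assoc, List.singleton_append] at h
      obtain ⟨hxy, huw⟩ := replicate_false_append_true_cons_inj h
      rw [he hxy, ih huw]

/-- Evaluation commutes with taking images under a map of words that preserves concatenation. -/
theorem eval_image {X Y : Type} (f : List X → List Y) (f_nil : f [] = [])
    (f_append : ∀ u w, f (u ++ w) = f u ++ f w)
    (f_flatten : ∀ ws : List (List X), f ws.flatten = (ws.map f).flatten)
    (v : ℕ → Set (List X)) (t : KA) :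
    eval (fun x => f '' v x) t = f '' eval v t := by
  induction t with
  | var x => rfl
  | zero => simp [eval]
  | one => simp [eval, f_nil]
  | add t s iht ihs => simp only [eval, iht, ihs, Set.image_union]
  | comp t s iht ihs =>
    simp only [eval, iht, ihs]
    ext w
    constructor
    · rintro ⟨_, ⟨a, ha, rfl⟩, _, ⟨b, hb, rfl⟩, rfl⟩
      exact ⟨a ++ b, ⟨a, ha, b, hb, rfl⟩, f_append a b⟩
    · rintro ⟨_, ⟨a, ha, b, hb, rfl⟩, rfl⟩
      exact ⟨f a, ⟨a, ha, rfl⟩, f b, ⟨b, hb, rfl⟩, f_append a b⟩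
  | star t iht =>
    simp only [eval, iht]
    ext w
    constructor
    · rintro ⟨ws, hws, rfl⟩
      obtain ⟨us, hus, rfl⟩ : ∃ us : List (List X), (∀ u ∈ us, u ∈ eval v t) ∧ us.map f = ws := by
        induction ws with
        | nil => exact ⟨[], by simp, rfl⟩
        | cons w ws ih =>
          obtain ⟨us, hus, rfl⟩ := ih fun u hu => hws u (List.mem_cons_of_mem _ hu)
          obtain ⟨a, ha, rfl⟩ := hws w List.mem_cons_self
          exact ⟨a :: us, List.forall_mem_cons.2 ⟨ha, hus⟩, rfl⟩
      exact ⟨us.flatten, ⟨us, hus, rfl⟩, f_flatten us⟩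
    · rintro ⟨_, ⟨us, hus, rfl⟩, rfl⟩
      refine ⟨us.map f, ?_, f_flatten us⟩
      intro u hu
      obtain ⟨a, ha, rfl⟩ := List.mem_map.1 hu
      exact ⟨a, hus a ha, rfl⟩

/-- For `n ≥ 2` and KA terms `t`, `s`: `LANG_n ⊨ t ≤ s` iff `LANG_2 ⊨ t ≤ s`. -/
theorem stmt17 (n : ℕ) (hn : 2 ≤ n) (t s : KA) :
    (∀ (X : Type), Cardinal.mk X ≤ n →
      ∀ v : ℕ → Set (List X), eval v t ⊆ eval v s) ↔
    (∀ (X : Type), Cardinal.mk X ≤ 2 →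
      ∀ v : ℕ → Set (List X), eval v t ⊆ eval v s) := by
  constructor
  · intro h X hX
    exact h X (hX.trans (by exact_mod_cast hn))
  · intro h X hX v w hw
    have : Countable X :=
      Cardinal.mk_le_aleph0_iff.1 (hX.trans (Cardinal.natCast_lt_aleph0 (n := n)).le)
    obtain ⟨e, he⟩ := exists_injective_nat X
    have image_eq := eval_image (unaryCode e) rfl (unaryCode_append e) (unaryCode_flatten e) v
    have hsub := h Bool (by simp) fun x => unaryCode e '' v x
    rw [image_eq, image_eq] at hsub
    exact (unaryCode_injective he).mem_set_image.1 (hsub ⟨w, hw, rfl⟩)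
end
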